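/- Let α > 0, let r satisfy 0 < r ≤ α, and let ρ satisfy 0 < ρ ≤ r/2. Set h₁ = ρ(2α−ρ)/(2(α+r−ρ)) and 𝒞(h₁) = {x ∈ ℝ² : −h₁ ≤ ⟨x,e₂⟩ ≤ 0} ∩ B(−r e₂, r). Then μ(𝒞(h₁)) ≥ (√2/3)·r^{1/2}·ρ^{3/2}. -/

import Mathlib

open MeasureTheory Metric Set
open scoped RealInnerProductSpace ENNReal

noncomputable section

/-- The Euclidean plane. -/
abbrev E2 := EuclideanSpace ℝ (Fin 2)

/-- The point `(a, b)` of the Euclidean plane. -/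
def pt (a b : ℝ) : E2 := (WithLp.equiv 2 (Fin 2 → ℝ)).symm ![a, b]

/-- The unit vector `e₂ = (0, 1)`. -/
def e₂ : E2 := pt 0 1

/-- `𝒞(h) = {x : −h ≤ ⟪x, e₂⟫ ≤ 0} ∩ B(−r e₂, r)`. -/
def Cset (h r : ℝ) : Set E2 :=
  {x : E2 | -h ≤ ⟪x, e₂⟫ ∧ ⟪x, e₂⟫ ≤ 0} ∩ closedBall (-(r • e₂)) r

theorem statement12
    (α r ρ : ℝ) (hα : 0 < α) (hr : 0 < r) (hrα : r ≤ α) (hρ : 0 < ρ) (hρr : ρ ≤ r / 2)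
    (h₁ : ℝ) (hh₁ : h₁ = ρ * (2 * α - ρ) / (2 * (α + r - ρ))) :
    ENNReal.ofReal (Real.sqrt 2 / 3 * r ^ ((1 : ℝ) / 2) * ρ ^ ((3 : ℝ) / 2))
      ≤ volume (Cset h₁ r) := by
  have ha2 : Real.sqrt (r * ρ / 2) ^ 2 = r * ρ / 2 := Real.sq_sqrt (by positivity)
  have ha0 : 0 ≤ Real.sqrt (r * ρ / 2) := Real.sqrt_nonneg _
  have hval : Real.sqrt 2 / 3 * r ^ ((1 : ℝ) / 2) * ρ ^ ((3 : ℝ) / 2)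
      = 2 / 3 * ρ * Real.sqrt (r * ρ / 2) := by
    have e1 : ρ ^ ((3 : ℝ) / 2) = ρ * Real.sqrt ρ := by
      rw [Real.sqrt_eq_rpow, show (3 : ℝ) / 2 = 1 + 1 / 2 by norm_num, Real.rpow_add hρ,
        Real.rpow_one]
    rw [e1, ← Real.sqrt_eq_rpow, Real.sqrt_div (by positivity), Real.sqrt_mul hr.le]
    have h2 : Real.sqrt 2 ^ 2 = 2 := Real.sq_sqrt (by norm_num)
    have h2p : 0 < Real.sqrt 2 := by positivity
    field_simp
    rw [h2]
  rw [hval]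
  generalize Real.sqrt (r * ρ / 2) = a at ha2 ha0
  have hh : ρ / 2 ≤ h₁ := by
    rw [hh₁, div_le_div_iff₀ (by norm_num) (by linarith)]
    nlinarith [mul_nonneg hρ.le (sub_nonneg.2 hrα)]
  have hmp := (volume_preserving_finTwoArrow ℝ).comp (PiLp.volume_preserving_ofLp (Fin 2))
  have hmeas : MeasurableSet (regionBetween (fun _ : ℝ => -(ρ / 2)) (fun x => -(x ^ 2 / r)) (Icc (-a) a)) :=
    measurableSet_regionBetween (by fun_prop) (by fun_prop) measurableSet_Icc
  have hsub : (MeasurableEquiv.finTwoArrow ∘ (WithLp.ofLp : E2 → Fin 2 → ℝ)) ⁻¹'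
      (regionBetween (fun _ : ℝ => -(ρ / 2)) (fun x => -(x ^ 2 / r)) (Icc (-a) a)) ⊆ Cset h₁ r := by
    intro x hx
    simp only [regionBetween, mem_preimage, mem_ofPred_eq, Function.comp, mem_Ioo,
      MeasurableEquiv.finTwoArrow_apply] at hx
    obtain ⟨-, h3, h4⟩ := hx
    have h5 : x 0 ^ 2 / r < - x 1 := by linarith
    rw [div_lt_iff₀ hr] at h5
    have h6 : 0 ≤ x 0 ^ 2 / r := by positivity
    have hin : ⟪x, e₂⟫ = x 1 := by
      simp [e₂, pt, PiLp.inner_apply, Fin.sum_univ_two]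
    refine ⟨?_, ?_⟩
    · rw [mem_ofPred_eq, hin]
      constructor <;> linarith
    · rw [mem_closedBall, EuclideanSpace.dist_eq]
      apply Real.sqrt_le_iff.2 ⟨hr.le, ?_⟩
      simp [e₂, pt, Fin.sum_univ_two, Real.dist_eq, sq_abs]
      nlinarith
  refine le_trans ?_ (measure_mono hsub)
  rw [hmp.measure_preimage hmeas.nullMeasurableSet]
  have hc1 : Continuous (fun _ : ℝ => -(ρ / 2)) := by fun_prop
  have hc2 : Continuous (fun x : ℝ => -(x ^ 2 / r)) := by fun_prop
  have := volume_regionBetween_eq_integral (μ := volume)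
    (hc1.continuousOn.integrableOn_Icc (a := -a) (b := a))
    (hc2.continuousOn.integrableOn_Icc (a := -a) (b := a)) measurableSet_Icc (by
      intro x hx
      have : x ^ 2 ≤ a ^ 2 := sq_le_sq' hx.1 hx.2
      simp only [neg_le_neg_iff]
      rw [div_le_iff₀ hr]; linarith)
  rw [← Measure.volume_eq_prod] at this
  rw [this]
  apply ENNReal.ofReal_le_ofReal
  rw [integral_Icc_eq_integral_Ioc, ← intervalIntegral.integral_of_le (by linarith)]
  have hint : ∫ x in (-a)..a, ((fun x : ℝ => -(x ^ 2 / r)) - (fun _ : ℝ => -(ρ / 2))) x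
      = a * ρ - 2 * a ^ 3 / (3 * r) := by
    have : ∀ x, ((fun x : ℝ => -(x ^ 2 / r)) - (fun _ : ℝ => -(ρ / 2))) x
      = ρ / 2 - x ^ 2 / r := by intro x; simp only [Pi.sub_apply]; ring
    simp_rw [this]
    rw [intervalIntegral.integral_sub (by simp) (Continuous.intervalIntegrable (by fun_prop) _ _),
      intervalIntegral.integral_div, intervalIntegral.integral_div, integral_pow]
    simp
    field_simp
    ring
  rw [hint]
  have : 2 * a ^ 3 / (3 * r) = a * ρ / 3 := by
    rw [pow_succ, ha2]; field_simp
  rw [this]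
  linarith
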